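/- arXiv:2409.07968 — 3 statements merged into one kernel-verified Lean document; each statement's English description precedes it below -/
import Mathlib

section
/- Fix a bandwidth ε>0, training samples x^{(1)},…,x^{(M)} ∈ ℝ^d, t^{(j)}(x) = exp(−‖x−x^{(j)}‖²/(4ε)), a vector v ∈ ℝ^M with strictly positive entries, w^{(j)}(x) = v^{(j)} t^{(j)}(x) / Σ_i v^{(i)} t^{(i)}(x), and m(x;ε) = Σ_j x^{(j)} w^{(j)}(x). Define the (unnormalized) density p_ε(x) = (Σ_{j=1}^M v^{(j)} t^{(j)}(x))². Then p_ε is everywhere positive and differentiable on ℝ^d, its log-gradient satisfies ∇ log p_ε(x) = (1/ε)(m(x;ε) − x), and consequently m(x;ε) = x + ε ∇ log p_ε(x) for all x ∈ ℝ^d. -/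
open Real Finset

section GaussianKernel

variable {F : Type*} [NormedAddCommGroup F] [InnerProductSpace ℝ F]

theorem hasFDerivAt_exp_neg_norm_sub_sq_div (c : ℝ) (a x : F) :
    HasFDerivAt (fun y => Real.exp (-‖y - a‖ ^ 2 / c))
      (Real.exp (-‖x - a‖ ^ 2 / c) • (2 / c) • innerSL ℝ (a - x)) x := by
  have h := (((hasFDerivAt_id (𝕜 := ℝ) x).sub_const a).norm_sq.neg.mul_const c⁻¹).exp
  refine (h.congr_fderiv ?_).congr_of_eventuallyEq (.of_forall fun y => ?_)
  · ext z
    simp [div_eq_mul_inv]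
    ring
  · simp [div_eq_mul_inv]

variable [CompleteSpace F]

theorem hasGradientAt_sum_mul_exp_neg_norm_sub_sq_div {ι : Type*} [Fintype ι]
    (c : ℝ) (v : ι → ℝ) (a : ι → F) (x : F) :
    HasGradientAt (fun y => ∑ j, v j * Real.exp (-‖y - a j‖ ^ 2 / c))
      ((2 / c) • ∑ j, (v j * Real.exp (-‖x - a j‖ ^ 2 / c)) • (a j - x)) x := by
  rw [hasGradientAt_iff_hasFDerivAt]
  refine (HasFDerivAt.fun_sum fun j _ =>
    (hasFDerivAt_exp_neg_norm_sub_sq_div c (a j) x).const_mul (v j)).congr_fderiv ?_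
  ext z
  simp only [_root_.sum_apply, smul_apply, innerSL_apply_apply,
    InnerProductSpace.toDual_apply_apply, sum_inner, real_inner_smul_left, smul_eq_mul,
    Finset.mul_sum]
  exact Finset.sum_congr rfl fun j _ => by ring

theorem HasGradientAt.log_sq {f : F → ℝ} {g x : F} (hf : HasGradientAt f g x) (hx : f x ≠ 0) :
    HasGradientAt (fun y => Real.log (f y ^ 2)) ((2 / f x) • g) x := by
  rw [hasGradientAt_iff_hasFDerivAt] at hf ⊢
  simp only [Real.log_pow]
  refine ((hf.log hx).const_mul _).congr_fderiv ?_
  ext z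
  simp
  ring

end GaussianKernel

/-- gradient structure of the Schrödinger bridge conditional mean.
With `p_ε(x) = (∑_j v^{(j)} t^{(j)}(x))²`, the density `p_ε` is positive and
differentiable, `∇ log p_ε(x) = (1/ε)(m(x;ε) − x)`, and hence
`m(x;ε) = x + ε ∇ log p_ε(x)`. -/
theorem schrodinger_bridge_gradient_structure
    (d M : ℕ) (hM : 0 < M) (ε : ℝ) (hε : 0 < ε)
    (xs : Fin M → EuclideanSpace ℝ (Fin d))
    (v : Fin M → ℝ) (hv : ∀ j, 0 < v j)
    (t : EuclideanSpace ℝ (Fin d) → Fin M → ℝ)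
    (ht : ∀ x j, t x j = Real.exp (-‖x - xs j‖ ^ 2 / (4 * ε)))
    (w : EuclideanSpace ℝ (Fin d) → Fin M → ℝ)
    (hw : ∀ x j, w x j = v j * t x j / ∑ i, v i * t x i)
    (m : EuclideanSpace ℝ (Fin d) → EuclideanSpace ℝ (Fin d))
    (hm : ∀ x, m x = ∑ j, w x j • xs j)
    (p : EuclideanSpace ℝ (Fin d) → ℝ)
    (hp : ∀ x, p x = (∑ j, v j * t x j) ^ 2) :
    (∀ x, 0 < p x) ∧ Differentiable ℝ p ∧
    (∀ x, gradient (fun y => Real.log (p y)) x = (1 / ε) • (m x - x)) ∧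
    (∀ x, m x = x + ε • gradient (fun y => Real.log (p y)) x) := by
  have hS : ∀ x, 0 < ∑ j, v j * t x j := fun x => by
    have : Nonempty (Fin M) := ⟨⟨0, hM⟩⟩
    refine Finset.sum_pos (fun j _ => mul_pos (hv j) ?_) Finset.univ_nonempty
    rw [ht]
    exact Real.exp_pos _
  have hSgrad : ∀ x, HasGradientAt (fun y => ∑ j, v j * t y j)
      ((2 / (4 * ε)) • ∑ j, (v j * t x j) • (xs j - x)) x := fun x => by
    simp only [ht]
    exact hasGradientAt_sum_mul_exp_neg_norm_sub_sq_div (4 * ε) v xs x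
  have hmean : ∀ x, (∑ i, v i * t x i)⁻¹ • ∑ j, (v j * t x j) • (xs j - x) = m x - x := fun x => by
    simp only [hm, hw, smul_sub, Finset.sum_sub_distrib, ← Finset.sum_smul,
      inv_smul_smul₀ (hS x).ne', Finset.smul_sum, smul_smul, div_eq_inv_mul]
  have hgrad : ∀ x, gradient (fun y => Real.log (p y)) x = (1 / ε) • (m x - x) := fun x => by
    simp only [hp]
    rw [((hSgrad x).log_sq (hS x).ne').gradient, ← hmean, smul_smul, smul_smul]
    have := (hS x).ne'
    congr 1
    field_simp
    norm_num
  refine ⟨fun x => ?_, fun x => ?_, hgrad, fun x => ?_⟩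
  · rw [hp]
    exact pow_pos (hS x) 2
  · rw [funext hp]
    exact (hSgrad x).differentiableAt.pow 2
  · rw [hgrad, smul_smul, mul_one_div_cancel hε.ne', one_smul, add_sub_cancel]
end

section
/- (Tweedie's formula.) Let γ>0 and let π be a probability density on ℝ^d with finite first moment ∫ ‖x'‖ π(x') dx' < ∞. Define the smoothed (unnormalized) marginal π_γ(x) = ∫_{ℝ^d} exp(−‖x−x'‖²/(2γ)) π(x') dx'. Then π_γ is everywhere positive and differentiable, the conditional mean E[x'|x] = (∫ x' exp(−‖x−x'‖²/(2γ)) π(x') dx') / π_γ(x) is well defined, and ∇ log π_γ(x) = −(1/γ)(x − E[x'|x]) for all x ∈ ℝ^d. -/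
open Real MeasureTheory

section GaussianSmoothing

variable {E : Type*} [NormedAddCommGroup E]

lemma hasFDerivAt_exp_neg_norm_sub_sq [InnerProductSpace ℝ E] (γ : ℝ) (a x : E) :
    HasFDerivAt (fun y => Real.exp (-‖y - a‖ ^ 2 / (2 * γ)))
      (innerSL ℝ (Real.exp (-‖x - a‖ ^ 2 / (2 * γ)) • (-(1 / γ)) • (x - a))) x := by
  have h := (((hasFDerivAt_id x).sub_const a).norm_sq.neg.mul_const ((2 * γ)⁻¹)).exp
  simp only [id, ← div_eq_mul_inv, Pi.neg_apply] at h
  refine h.congr_fderiv ?_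
  ext y
  simp
  ring

lemma exp_neg_sq_div_le_one {γ : ℝ} (hγ : 0 ≤ γ) (t : ℝ) :
    Real.exp (-t ^ 2 / (2 * γ)) ≤ 1 :=
  Real.exp_le_one_iff.2 (div_nonpos_of_nonpos_of_nonneg (by nlinarith [sq_nonneg t]) (by positivity))

variable [MeasurableSpace E] [BorelSpace E] [SecondCountableTopology E]
  {μ : Measure E} {p : E → ℝ} {γ : ℝ}

lemma integrable_exp_neg_norm_sub_sq_mul (hγ : 0 ≤ γ) (hp : Integrable p μ) (x : E) :
    Integrable (fun a => Real.exp (-‖x - a‖ ^ 2 / (2 * γ)) * p a) μ :=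
  hp.bdd_mul (c := 1) (by fun_prop) <| .of_forall fun a => by
    simpa using exp_neg_sq_div_le_one hγ ‖x - a‖

lemma integrable_exp_neg_norm_sub_sq_mul_smul [NormedSpace ℝ E] (hγ : 0 ≤ γ) (hp : Integrable p μ)
    (hp1 : Integrable (fun a => ‖a‖ * p a) μ) (x : E) :
    Integrable (fun a => (Real.exp (-‖x - a‖ ^ 2 / (2 * γ)) * p a) • a) μ := by
  have hm := (integrable_exp_neg_norm_sub_sq_mul hγ hp x).aestronglyMeasurable
  refine hp1.mono (hm.smul aestronglyMeasurable_id) (.of_forall fun a => ?_)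
  rw [norm_smul, norm_mul, norm_mul, norm_norm, Real.norm_of_nonneg (Real.exp_nonneg _),
    mul_comm ‖a‖]
  gcongr
  exact mul_le_of_le_one_left (norm_nonneg _) (exp_neg_sq_div_le_one hγ _)

lemma integral_exp_neg_norm_sub_sq_mul_pos (hγ : 0 ≤ γ) (hp : Integrable p μ) (hp0 : ∀ a, 0 ≤ p a)
    (hpos : 0 < ∫ a, p a ∂μ) (x : E) :
    0 < ∫ a, Real.exp (-‖x - a‖ ^ 2 / (2 * γ)) * p a ∂μ := by
  rw [integral_pos_iff_support_of_nonneg hp0 hp] at hpos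
  rw [integral_pos_iff_support_of_nonneg (fun a => mul_nonneg (Real.exp_nonneg _) (hp0 a))
    (integrable_exp_neg_norm_sub_sq_mul hγ hp x)]
  convert hpos using 2
  ext a
  simp [Real.exp_ne_zero]

lemma hasGradientAt_integral_exp_neg_norm_sub_sq_mul [InnerProductSpace ℝ E] [CompleteSpace E]
    (hγ : 0 ≤ γ) (hp : Integrable p μ) (hp1 : Integrable (fun a => ‖a‖ * p a) μ) (x : E) :
    HasGradientAt (fun y => ∫ a, Real.exp (-‖y - a‖ ^ 2 / (2 * γ)) * p a ∂μ)
      ((-(1 / γ)) • ((∫ a, Real.exp (-‖x - a‖ ^ 2 / (2 * γ)) * p a ∂μ) • x -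
        ∫ a, (Real.exp (-‖x - a‖ ^ 2 / (2 * γ)) * p a) • a ∂μ)) x := by
  have hI (y : E) := integrable_exp_neg_norm_sub_sq_mul hγ hp y
  have hJ := integrable_exp_neg_norm_sub_sq_mul_smul hγ hp hp1 x
  set v : E → E → E := fun y a =>
    (-(1 / γ)) • ((Real.exp (-‖y - a‖ ^ 2 / (2 * γ)) * p a) • y -
      (Real.exp (-‖y - a‖ ^ 2 / (2 * γ)) * p a) • a) with hv
  have hvx : Integrable (v x) μ := (((hI x).smul_const x).sub hJ).smul _
  have hsum : ∫ a, v x a ∂μ = (-(1 / γ)) • ((∫ a, Real.exp (-‖x - a‖ ^ 2 / (2 * γ)) * p a ∂μ) • x -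
      ∫ a, (Real.exp (-‖x - a‖ ^ 2 / (2 * γ)) * p a) • a ∂μ) := by
    rw [hv, integral_smul, integral_sub ((hI x).smul_const x) hJ, integral_smul_const]
  have hmeas : AEStronglyMeasurable (fun a => innerSL ℝ (v x a)) μ :=
    (innerSL ℝ (E := E)).continuous.comp_aestronglyMeasurable hvx.aestronglyMeasurable
  have hbound : ∀ a, ∀ y ∈ Metric.ball x 1,
      ‖innerSL ℝ (v y a)‖ ≤ 1 / γ * ((‖x‖ + 1) * ‖p a‖ + ‖‖a‖ * p a‖) := by
    intro a y hy
    have hy' : ‖y‖ ≤ ‖x‖ + 1 := by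
      have h := norm_le_norm_add_norm_sub x y
      rw [mem_ball_iff_norm] at hy
      rw [norm_sub_rev] at h
      linarith
    have hle : ‖y - a‖ ≤ ‖x‖ + 1 + ‖a‖ := (norm_sub_le y a).trans (by gcongr)
    rw [innerSL_apply_norm, hv]
    simp only
    rw [← smul_sub, norm_smul, norm_smul, norm_neg, norm_mul, norm_mul, norm_norm,
      Real.norm_of_nonneg (Real.exp_nonneg _), Real.norm_of_nonneg (by positivity : 0 ≤ 1 / γ)]
    gcongr
    calc _ ≤ (1 * ‖p a‖) * (‖x‖ + 1 + ‖a‖) := by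
          gcongr
          exact exp_neg_sq_div_le_one hγ _
      _ = _ := by ring
  have hderiv : ∀ a, ∀ y ∈ Metric.ball x 1,
      HasFDerivAt (fun y => Real.exp (-‖y - a‖ ^ 2 / (2 * γ)) * p a) (innerSL ℝ (v y a)) y := by
    intro a y _
    refine ((hasFDerivAt_exp_neg_norm_sub_sq γ a y).mul_const (p a)).congr_fderiv ?_
    ext z
    simp [hv]
    ring
  have key := hasFDerivAt_integral_of_dominated_of_fderiv_le (Metric.ball_mem_nhds x one_pos)
    (.of_forall fun y => (hI y).aestronglyMeasurable) (hI x) hmeas (.of_forall hbound)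
    (((hp.norm.const_mul _).add hp1.norm).const_mul _) (.of_forall hderiv)
  rw [hasGradientAt_iff_hasFDerivAt, ← hsum]
  refine key.congr_fderiv ?_
  ext z
  have hinner : Integrable (fun a => innerSL ℝ (v x a)) μ :=
    hvx.norm.mono' hmeas (.of_forall fun a => by simp)
  rw [ContinuousLinearMap.integral_apply hinner]
  simp only [InnerProductSpace.toDual_apply_apply, innerSL_apply_apply]
  simp_rw [fun w : E => real_inner_comm z w]
  exact integral_inner (𝕜 := ℝ) hvx z

end GaussianSmoothing

/-- Tweedie's formula: for a probability density `pr` on ℝ^d with finite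
first moment and the Gaussian-smoothed unnormalized marginal
`prγ(x) = ∫ exp(−‖x−x'‖²/(2γ)) pr(x') dx'`, the function `prγ` is positive and
differentiable, the conditional mean `E[x'|x]` is well defined, and
`∇ log prγ(x) = −(1/γ)(x − E[x'|x])`. -/
theorem tweedie_formula
    (d : ℕ) (γ : ℝ) (hγ : 0 < γ)
    (pr : EuclideanSpace ℝ (Fin d) → ℝ)
    (hpr_meas : Measurable pr)
    (hpr_nonneg : ∀ x, 0 ≤ pr x)
    (hpr_prob : ∫ x, pr x = 1)
    (hpr_moment : Integrable (fun x => ‖x‖ * pr x))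
    (prγ : EuclideanSpace ℝ (Fin d) → ℝ)
    (hprγ : ∀ x, prγ x = ∫ x', Real.exp (-‖x - x'‖ ^ 2 / (2 * γ)) * pr x')
    (condMean : EuclideanSpace ℝ (Fin d) → EuclideanSpace ℝ (Fin d))
    (hcondMean : ∀ x, condMean x =
      (prγ x)⁻¹ • ∫ x', (Real.exp (-‖x - x'‖ ^ 2 / (2 * γ)) * pr x') • x') :
    (∀ x, 0 < prγ x) ∧ Differentiable ℝ prγ ∧
    (∀ x, Integrable (fun x' => (Real.exp (-‖x - x'‖ ^ 2 / (2 * γ)) * pr x') • x')) ∧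
    (∀ x, gradient (fun y => Real.log (prγ y)) x = (-(1 / γ)) • (x - condMean x)) := by
  have hp : Integrable pr := by
    by_contra h
    simp [integral_undef h] at hpr_prob
  have hpos (x) : 0 < prγ x := by
    rw [hprγ]
    exact integral_exp_neg_norm_sub_sq_mul_pos hγ.le hp hpr_nonneg (by simp [hpr_prob]) x
  have hgrad (x) := hasGradientAt_integral_exp_neg_norm_sub_sq_mul hγ.le hp hpr_moment x
  simp only [← hprγ] at hgrad
  refine ⟨hpos, fun x => (hgrad x).differentiableAt,
    integrable_exp_neg_norm_sub_sq_mul_smul hγ.le hp hpr_moment, fun x => ?_⟩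
  refine HasGradientAt.gradient ?_
  rw [hasGradientAt_iff_hasFDerivAt]
  refine ((hasGradientAt_iff_hasFDerivAt.1 (hgrad x)).log (hpos x).ne').congr_fderiv ?_
  rw [← map_smul, hcondMean, smul_comm, smul_sub, inv_smul_smul₀ (hpos x).ne']
end

section
/- (Geometric ergodicity of the localized sampler.) Let ε > 0 and let m : ℝ^d → ℝ^d be a measurable map with uniformly bounded range, ‖m(x)‖ ≤ B for all x ∈ ℝ^d. Consider the Markov kernel κ on ℝ^d given by κ(x, ·) = N(m(x), 2εI), i.e., the transition density n(x'; m(x), 2εI) = (4πε)^{−d/2} exp(−‖x'−m(x)‖²/(4ε)). Then κ possesses a unique invariant probability measure μ, and the chain is geometrically ergodic: there exist constants K > 0 and ρ ∈ (0,1) such that for every x ∈ ℝ^d and every n ≥ 1 the total variation distance satisfies ‖κⁿ(x, ·) − μ‖_TV ≤ K (1 + ‖x‖²) ρⁿ. -/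
open MeasureTheory Real

section Doeblin

variable {E : Type*} [MeasurableSpace E] {κ : E → Measure E} {η : Measure E}

/-- The residual family `x ↦ κ x - η` of a minorized measurable family is measurable. -/
lemma measurable_sub_of_minorized [IsFiniteMeasure η] (hκ : Measurable κ)
    (hη : ∀ x, η ≤ κ x) : Measurable fun x => κ x - η := by
  refine Measure.measurable_of_measurable_coe _ fun s hs => ?_
  simp_rw [fun x => Measure.sub_apply hs (hη x)]
  exact ((Measure.measurable_coe hs).comp hκ).sub_const _

/-- One step of a minorized kernel splits into a residual step and a regeneration from `η`. -/
lemma bind_eq_bind_sub_add [IsFiniteMeasure η] (hκ : Measurable κ) (hη : ∀ x, η ≤ κ x)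
    (ν : Measure E) : ν.bind κ = ν.bind (fun x => κ x - η) + ν Set.univ • η := by
  have hR := measurable_sub_of_minorized hκ hη
  ext s hs
  rw [Measure.add_apply, Measure.smul_apply, Measure.bind_apply hs hκ.aemeasurable,
    Measure.bind_apply hs hR.aemeasurable, smul_eq_mul, mul_comm, ← lintegral_const,
    ← lintegral_add_right _ measurable_const]
  refine lintegral_congr fun x => ?_
  rw [← Measure.add_apply, Measure.sub_add_cancel_of_le (hη x)]

lemma bind_sub_univ [IsFiniteMeasure η] (hκ : Measurable κ)
    (hprob : ∀ x, IsProbabilityMeasure (κ x)) (hη : ∀ x, η ≤ κ x) (ν : Measure E) :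
    ν.bind (fun x => κ x - η) Set.univ = (1 - η Set.univ) * ν Set.univ := by
  rw [Measure.bind_apply .univ (measurable_sub_of_minorized hκ hη).aemeasurable]
  simp_rw [fun x => Measure.sub_apply .univ (hη x), measure_univ]
  exact lintegral_const _

lemma iterate_bind_sub_univ [IsFiniteMeasure η] (hκ : Measurable κ)
    (hprob : ∀ x, IsProbabilityMeasure (κ x)) (hη : ∀ x, η ≤ κ x) (ν : Measure E) (n : ℕ) :
    (fun ν : Measure E => ν.bind fun x => κ x - η)^[n] ν Set.univ
      = (1 - η Set.univ) ^ n * ν Set.univ := by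
  induction n with
  | zero => simp
  | succ n ih =>
    rw [Function.iterate_succ_apply', bind_sub_univ hκ hprob hη, ih, pow_succ', mul_assoc]

lemma isProbabilityMeasure_iterate_bind (hκ : Measurable κ)
    (hprob : ∀ x, IsProbabilityMeasure (κ x)) (ν : Measure E) [hν : IsProbabilityMeasure ν]
    (n : ℕ) : IsProbabilityMeasure ((fun ν : Measure E => ν.bind κ)^[n] ν) := by
  induction n with
  | zero => exact hν
  | succ n ih =>
    rw [Function.iterate_succ_apply']
    constructor
    rw [Measure.bind_apply .univ hκ.aemeasurable]
    simp

/-- The law after `n` steps, decomposed according to the last regeneration. -/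
lemma iterate_bind_apply_eq [IsFiniteMeasure η] (hκ : Measurable κ)
    (hprob : ∀ x, IsProbabilityMeasure (κ x)) (hη : ∀ x, η ≤ κ x) (ν : Measure E)
    [IsProbabilityMeasure ν] (n : ℕ) :
    (fun ν : Measure E => ν.bind κ)^[n] ν
      = (fun ν : Measure E => ν.bind fun x => κ x - η)^[n] ν
        + Measure.sum fun k : Fin n => (fun ν : Measure E => ν.bind fun x => κ x - η)^[k] η := by
  have hR := measurable_sub_of_minorized hκ hη
  induction n with
  | zero =>
    ext s hs
    simp
  | succ n ih =>
    have := isProbabilityMeasure_iterate_bind hκ hprob ν n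
    rw [Function.iterate_succ_apply', bind_eq_bind_sub_add hκ hη, measure_univ, one_smul, ih]
    ext s hs
    simp only [Measure.add_apply, Measure.sum_apply _ hs, tsum_fintype,
      Measure.bind_apply hs hR.aemeasurable, lintegral_add_measure, lintegral_sum_measure,
      Fin.sum_univ_succ, Function.iterate_succ_apply', Fin.val_succ, Fin.val_zero,
      Function.iterate_zero_apply]
    ring

/-- Under a Doeblin minorization, the laws of the chain started from any two initial
probability measures merge at a geometric rate in total variation. -/
lemma abs_iterate_bind_sub_le [IsFiniteMeasure η] (hκ : Measurable κ)
    (hprob : ∀ x, IsProbabilityMeasure (κ x)) (hη : ∀ x, η ≤ κ x) (ν ν' : Measure E)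
    [IsProbabilityMeasure ν] [IsProbabilityMeasure ν'] (n : ℕ) {s : Set E} :
    |((fun ν : Measure E => ν.bind κ)^[n] ν).real s
      - ((fun ν : Measure E => ν.bind κ)^[n] ν').real s|
      ≤ (1 - η Set.univ).toReal ^ n := by
  have hmass (ν : Measure E) [IsProbabilityMeasure ν] :
      (fun ν : Measure E => ν.bind fun x => κ x - η)^[n] ν Set.univ
        = (1 - η Set.univ) ^ n := by
    simp [iterate_bind_sub_univ hκ hprob hη]
  have hle_one : (1 - η Set.univ) ^ n ≤ 1 := pow_le_one' tsub_le_self n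
  have hfin (ν : Measure E) [IsProbabilityMeasure ν] :
      IsFiniteMeasure ((fun ν : Measure E => ν.bind fun x => κ x - η)^[n] ν) :=
    ⟨by rw [hmass]; exact hle_one.trans_lt ENNReal.one_lt_top⟩
  have hle (ν : Measure E) [IsProbabilityMeasure ν] :
      ((fun ν : Measure E => ν.bind fun x => κ x - η)^[n] ν).real s
        ≤ (1 - η Set.univ).toReal ^ n := by
    have := hfin ν
    refine (measureReal_mono (Set.subset_univ s)).trans_eq ?_
    rw [measureReal_def, hmass, ENNReal.toReal_pow]
  have hsum : IsFiniteMeasure (Measure.sum fun k : Fin n =>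
      (fun ν : Measure E => ν.bind fun x => κ x - η)^[k] η) := by
    have := isProbabilityMeasure_iterate_bind hκ hprob ν n
    refine isFiniteMeasure_of_le ((fun ν : Measure E => ν.bind κ)^[n] ν) ?_
    rw [iterate_bind_apply_eq hκ hprob hη]
    exact Measure.le_add_left le_rfl
  have := hfin ν
  have := hfin ν'
  rw [iterate_bind_apply_eq hκ hprob hη, iterate_bind_apply_eq hκ hprob hη ν',
    measureReal_add_apply, measureReal_add_apply, add_sub_add_right_eq_sub, abs_le]
  constructor <;>
  linarith [hle ν, hle ν', measureReal_nonneg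
    (μ := (fun ν : Measure E => ν.bind fun x => κ x - η)^[n] ν) (s := s), measureReal_nonneg
    (μ := (fun ν : Measure E => ν.bind fun x => κ x - η)^[n] ν') (s := s)]

/-- A Doeblin-minorized Markov kernel has an invariant probability measure, namely the sum
of the laws of the residual chain started from `η`. -/
lemma exists_isProbabilityMeasure_bind_eq_self [Nonempty E] (hκ : Measurable κ)
    (hprob : ∀ x, IsProbabilityMeasure (κ x)) (hη : ∀ x, η ≤ κ x) (hη0 : η ≠ 0) :
    ∃ μ : Measure E, IsProbabilityMeasure μ ∧ μ.bind κ = μ := by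
  have hle : η Set.univ ≤ 1 := by
    obtain ⟨x⟩ := ‹Nonempty E›
    simpa using hη x Set.univ
  have : IsFiniteMeasure η := ⟨hle.trans_lt ENNReal.one_lt_top⟩
  have hR := measurable_sub_of_minorized hκ hη
  set a : ℕ → Measure E := fun k => (fun ν : Measure E => ν.bind fun x => κ x - η)^[k] η with ha
  have huniv : Measure.sum a Set.univ = 1 := by
    simp_rw [Measure.sum_apply _ .univ, ha, iterate_bind_sub_univ hκ hprob hη]
    rw [ENNReal.tsum_mul_right, ENNReal.tsum_geometric,
      ENNReal.sub_sub_cancel ENNReal.one_ne_top hle,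
      ENNReal.inv_mul_cancel (Measure.measure_univ_ne_zero.2 hη0) (measure_ne_top η _)]
  refine ⟨Measure.sum a, ⟨huniv⟩, ?_⟩
  rw [bind_eq_bind_sub_add hκ hη, huniv, one_smul]
  ext s hs
  rw [Measure.add_apply, Measure.bind_apply hs hR.aemeasurable, lintegral_sum_measure,
    Measure.sum_apply _ hs, tsum_eq_zero_add' (f := fun k => a k s) ENNReal.summable, add_comm]
  congr 1
  refine tsum_congr fun k => ?_
  rw [ha]
  simp only [Function.iterate_succ_apply']
  rw [Measure.bind_apply hs hR.aemeasurable]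

end Doeblin

section Gaussian

variable {d : ℕ} {ε : ℝ}

lemma lintegral_gaussian_density_eq_one (hε : 0 < ε) (a : EuclideanSpace ℝ (Fin d)) :
    ∫⁻ y, ENNReal.ofReal
      ((4 * π * ε) ^ (-(d : ℝ) / 2) * exp (-‖y - a‖ ^ 2 / (4 * ε))) = 1 := by
  have hb : 0 < (4 * ε)⁻¹ := by positivity
  have hform (y : EuclideanSpace ℝ (Fin d)) :
      exp (-‖y - a‖ ^ 2 / (4 * ε)) = exp (-(4 * ε)⁻¹ * ‖y - a‖ ^ 2) := by
    congr 1
    ring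
  have hgauss : ∫ y : EuclideanSpace ℝ (Fin d), exp (-(4 * ε)⁻¹ * ‖y - a‖ ^ 2)
      = (4 * π * ε) ^ ((d : ℝ) / 2) := by
    rw [integral_sub_right_eq_self (fun y : EuclideanSpace ℝ (Fin d) =>
      exp (-(4 * ε)⁻¹ * ‖y‖ ^ 2)) a, GaussianFourier.integral_rexp_neg_mul_sq_norm hb,
      finrank_euclideanSpace_fin]
    congr 1
    field_simp
  have hpos : 0 < (4 * π * ε) ^ ((d : ℝ) / 2) := by positivity
  simp_rw [hform]
  rw [← ofReal_integral_eq_lintegral_ofReal, integral_const_mul, hgauss, neg_div,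
    rpow_neg (by positivity), inv_mul_cancel₀ hpos.ne', ENNReal.ofReal_one]
  · exact (Integrable.of_integral_ne_zero (hgauss ▸ hpos.ne')).const_mul _
  · exact Filter.Eventually.of_forall fun y => by positivity

lemma exp_neg_sq_norm_sub_ge {F : Type*} [NormedAddCommGroup F] (hε : 0 < ε) {B : ℝ} {a : F}
    (ha : ‖a‖ ≤ B) (y : F) :
    exp (-(‖y‖ + B) ^ 2 / (4 * ε)) ≤ exp (-‖y - a‖ ^ 2 / (4 * ε)) := by
  gcongr
  exact (norm_sub_le y a).trans (by gcongr)

end Gaussian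

/-- geometric ergodicity of the localized sampler: the Markov kernel
`κ(x,·) = N(m(x), 2εI)` (given via its Gaussian transition density with respect to
Lebesgue measure) for a measurable drift `m` with uniformly bounded range possesses a
unique invariant probability measure `μ`, and the `n`-step transition probabilities
converge to `μ` geometrically fast in total variation, with a multiplicative constant
controlled by the Lyapunov function `1 + ‖x‖²`. -/
theorem localized_sampler_geometric_ergodicity
    (d : ℕ) (ε B : ℝ) (hε : 0 < ε)
    (m : EuclideanSpace ℝ (Fin d) → EuclideanSpace ℝ (Fin d))
    (hm_meas : Measurable m) (hm_bdd : ∀ x, ‖m x‖ ≤ B)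
    (κ : EuclideanSpace ℝ (Fin d) → Measure (EuclideanSpace ℝ (Fin d)))
    (hκ : ∀ x, κ x = volume.withDensity fun y =>
      ENNReal.ofReal
        ((4 * Real.pi * ε) ^ (-(d : ℝ) / 2) * Real.exp (-‖y - m x‖ ^ 2 / (4 * ε))))
    (κn : ℕ → EuclideanSpace ℝ (Fin d) → Measure (EuclideanSpace ℝ (Fin d)))
    (hκn0 : ∀ x, κn 0 x = Measure.dirac x)
    (hκnsucc : ∀ n x, κn (n + 1) x = (κn n x).bind κ) :
    ∃ μ : Measure (EuclideanSpace ℝ (Fin d)),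
      IsProbabilityMeasure μ ∧ μ.bind κ = μ ∧
      (∀ ν : Measure (EuclideanSpace ℝ (Fin d)),
        IsProbabilityMeasure ν → ν.bind κ = ν → ν = μ) ∧
      ∃ K > (0 : ℝ), ∃ ρ ∈ Set.Ioo (0 : ℝ) 1,
        ∀ (x : EuclideanSpace ℝ (Fin d)) (n : ℕ), 1 ≤ n →
          ∀ s : Set (EuclideanSpace ℝ (Fin d)), MeasurableSet s →
            |(κn n x s).toReal - (μ s).toReal| ≤ K * (1 + ‖x‖ ^ 2) * ρ ^ n := by
  have hmeas : Measurable κ := by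
    refine Measure.measurable_of_measurable_coe _ fun s hs => ?_
    simp_rw [hκ, withDensity_apply _ hs]
    refine Measurable.lintegral_prod_right' (f := fun p :
      EuclideanSpace ℝ (Fin d) × EuclideanSpace ℝ (Fin d) => ENNReal.ofReal
        ((4 * π * ε) ^ (-(d : ℝ) / 2) * exp (-‖p.2 - m p.1‖ ^ 2 / (4 * ε)))) ?_
    fun_prop
  have hprob (x) : IsProbabilityMeasure (κ x) :=
    ⟨by rw [hκ, withDensity_apply _ .univ, Measure.restrict_univ,
      lintegral_gaussian_density_eq_one hε]⟩
  set η : Measure (EuclideanSpace ℝ (Fin d)) := volume.withDensity fun y =>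
    ENNReal.ofReal ((4 * π * ε) ^ (-(d : ℝ) / 2) * exp (-(‖y‖ + B) ^ 2 / (4 * ε))) with hη_def
  have hη (x) : η ≤ κ x := by
    rw [hκ]
    refine withDensity_mono (Filter.Eventually.of_forall fun y => ?_)
    dsimp only
    gcongr ENNReal.ofReal (_ * ?_)
    exact exp_neg_sq_norm_sub_ge hε (hm_bdd x) y
  have hη0 : η ≠ 0 := by
    rw [hη_def, Ne, withDensity_eq_zero_iff (by fun_prop)]
    intro h
    obtain ⟨y, hy⟩ := h.exists
    have : 0 < (4 * π * ε) ^ (-(d : ℝ) / 2) * exp (-(‖y‖ + B) ^ 2 / (4 * ε)) := by positivity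
    exact this.not_ge (ENNReal.ofReal_eq_zero.1 hy)
  have hfin : IsFiniteMeasure η := isFiniteMeasure_of_le (κ 0) (hη 0)
  obtain ⟨μ, hμ, hμκ⟩ := exists_isProbabilityMeasure_bind_eq_self hmeas hprob hη hη0
  have hρ_lt : (1 - η Set.univ).toReal < 1 := by
    rw [← ENNReal.toReal_one]
    exact (ENNReal.toReal_lt_toReal (by simp) (by simp)).2
      (ENNReal.sub_lt_self (by simp) (by simp) (Measure.measure_univ_ne_zero.2 hη0))
  have hiter {ν : Measure (EuclideanSpace ℝ (Fin d))} (hν : ν.bind κ = ν) (n : ℕ) :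
      (fun ν : Measure (EuclideanSpace ℝ (Fin d)) => ν.bind κ)^[n] ν = ν :=
    Function.iterate_fixed hν n
  refine ⟨μ, hμ, hμκ, fun ν hν hνκ => ?_, 1, one_pos, max (1 - η Set.univ).toReal (1 / 2),
    ⟨by positivity, max_lt hρ_lt (by norm_num)⟩, fun x n hn s _ => ?_⟩
  · refine Measure.ext fun s _ => (measureReal_eq_measureReal_iff).1 ?_
    have hle (n : ℕ) : |ν.real s - μ.real s| ≤ (1 - η Set.univ).toReal ^ n := by
      simpa only [hiter hνκ, hiter hμκ] using
        abs_iterate_bind_sub_le hmeas hprob hη ν μ n (s := s)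
    have := ge_of_tendsto' (tendsto_pow_atTop_nhds_zero_of_lt_one ENNReal.toReal_nonneg hρ_lt) hle
    exact sub_eq_zero.1 (abs_nonpos_iff.1 this)
  · have hκn : κn n x
        = (fun ν : Measure (EuclideanSpace ℝ (Fin d)) => ν.bind κ)^[n] (Measure.dirac x) := by
      clear hn
      induction n with
      | zero => exact hκn0 x
      | succ n ih => rw [hκnsucc, Function.iterate_succ_apply', ih]
    have hle := abs_iterate_bind_sub_le hmeas hprob hη (Measure.dirac x) μ n (s := s)
    rw [hiter hμκ, ← hκn] at hle
    calc |(κn n x s).toReal - (μ s).toReal|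
        ≤ (1 - η Set.univ).toReal ^ n := hle
      _ ≤ max (1 - η Set.univ).toReal (1 / 2) ^ n := by
        gcongr
        exact le_max_left _ _
      _ ≤ 1 * (1 + ‖x‖ ^ 2) * max (1 - η Set.univ).toReal (1 / 2) ^ n := by
        refine le_mul_of_one_le_left (by positivity) ?_
        nlinarith [sq_nonneg ‖x‖]
end
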